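/- arXiv:2208.01365 — 2 statements merged into one kernel-verified Lean document; each statement's English description precedes it below -/
import Mathlib

section
/- Let (A^{(t)}, t ∈ [T]) follow the lazy IER process on [n] with mean matrix P and laziness parameter α ∈ (0,1), and let A = Σ_{t=1}^T A^{(t)}, Ā = E A. For any constant c > 0 there exists a constant C = C(c) > 0 (independent of n, T, P, α) such that: if T·d_max > C(log n)^3, then there is a constant C₁ = C₁(α, c) such that for every δ ∈ (n^{-c}, 1/2), with probability at least 1 − δ, ‖A − Ā‖ ≤ C₁ √(T · d_max · log(n/δ)). -/
open MeasureTheory ProbabilityTheory Finset Real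

noncomputable section

/-- Value of the Bernoulli(p) pmf at `b`. -/
def bernProb (p : ℝ) (b : Bool) : ℝ := if b then p else 1 - p

/-- One-step transition probability of a lazy Bernoulli edge process:
with probability `α` keep the previous state, with probability `1 - α`
resample from Bernoulli(p). -/
def lazyStep (p α : ℝ) (prev next : Bool) : ℝ :=
  (if next = prev then α else 0) + (1 - α) * bernProb p next

/-- Probability of observing the trajectory `m` (at times `1, …, T`) under the
lazy IER process with mean matrix `P` and laziness parameter `α`:
edges (pairs `i ≤ j`) evolve independently, each as a lazy Bernoulli chain. -/
def lazyTrajProb (n T : ℕ) (P : Matrix (Fin n) (Fin n) ℝ) (α : ℝ)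
    (m : ℕ → Fin n → Fin n → Bool) : ℝ :=
  ∏ ij ∈ Finset.univ.filter (fun ij : Fin n × Fin n => ij.1 ≤ ij.2),
    (bernProb (P ij.1 ij.2) (m 1 ij.1 ij.2) *
      ∏ t ∈ Finset.Icc 2 T, lazyStep (P ij.1 ij.2) α (m (t-1) ij.1 ij.2) (m t ij.1 ij.2))

/-- `A` (whose relevant time indices are `1, …, T`) is a lazy inhomogeneous
Erdős–Rényi process on the probability space `(Ω, μ)` with symmetric mean matrix
`P ∈ [0,1]^{n×n}` and laziness parameter `α ∈ (0,1)`. -/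
structure IsLazyIER {Ω : Type} [MeasurableSpace Ω] (μ : Measure Ω)
    (n T : ℕ) (P : Matrix (Fin n) (Fin n) ℝ) (α : ℝ)
    (A : ℕ → Ω → Fin n → Fin n → Bool) : Prop where
  prob : IsProbabilityMeasure μ
  two_le_T : 2 ≤ T
  alpha_mem : α ∈ Set.Ioo (0 : ℝ) 1
  P_symm : ∀ i j, P i j = P j i
  P_mem : ∀ i j, P i j ∈ Set.Icc (0 : ℝ) 1
  A_symm : ∀ t ω i j, A t ω i j = A t ω j i
  meas : ∀ t, Measurable (A t)
  law : ∀ m : ℕ → Fin n → Fin n → Bool, (∀ t i j, m t i j = m t j i) →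
    (μ {ω | ∀ t ∈ Finset.Icc 1 T, A t ω = m t}).toReal = lazyTrajProb n T P α m

/-- Entry `(i,j)` of the aggregated adjacency matrix `A = Σ_{t=1}^T A^{(t)}`. -/
def aggE {Ω : Type} (n T : ℕ) (A : ℕ → Ω → Fin n → Fin n → Bool)
    (ω : Ω) (i j : Fin n) : ℝ :=
  ∑ t ∈ Finset.Icc 1 T, if A t ω i j then (1 : ℝ) else 0

/-- The aggregated adjacency matrix as a random matrix. -/
def aggMatrix {Ω : Type} (n T : ℕ) (A : ℕ → Ω → Fin n → Fin n → Bool)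
    (ω : Ω) : Matrix (Fin n) (Fin n) ℝ :=
  Matrix.of fun i j => aggE n T A ω i j

/-- Entrywise expectation `Ā = E A` of the aggregated adjacency matrix. -/
def aggMean {Ω : Type} [MeasurableSpace Ω] (μ : Measure Ω)
    (n T : ℕ) (A : ℕ → Ω → Fin n → Fin n → Bool) : Matrix (Fin n) (Fin n) ℝ :=
  Matrix.of fun i j => ∫ ω, aggE n T A ω i j ∂μ

/-- The operator (spectral) norm of a real matrix, i.e. the norm of the induced
linear map between Euclidean spaces. -/
def opNorm {k l : ℕ} (M : Matrix (Fin k) (Fin l) ℝ) : ℝ :=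
  ‖LinearMap.toContinuousLinearMap (Matrix.toEuclideanLin M)‖

/-- Maximum expected degree `d_max = max_i Σ_j p_ij`. -/
def dMax {n : ℕ} (P : Matrix (Fin n) (Fin n) ℝ) : ℝ := ⨆ i, ∑ j, P i j

/-- Minimum expected degree `d_min = min_i Σ_j p_ij`. -/
def dMin {n : ℕ} (P : Matrix (Fin n) (Fin n) ℝ) : ℝ := ⨅ i, ∑ j, P i j

/-- Weight of a trajectory `b` of length `T + 1` under the lazy Bernoulli chain. -/
def chainWeight (p α : ℝ) {T : ℕ} (b : Fin (T + 1) → Bool) : ℝ :=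
  bernProb p (b 0) * ∏ k : Fin T, lazyStep p α (b k.castSucc) (b k.succ)

/-- Number of times at which the trajectory `b` is in the state `true`. -/
def pathSum {T : ℕ} (b : Fin (T + 1) → Bool) : ℝ := ∑ k, if b k then (1 : ℝ) else 0

lemma chainWeight_snoc (p α : ℝ) {T : ℕ} (b : Fin (T + 1) → Bool) (y : Bool) :
    chainWeight p α (Fin.snoc b y : Fin (T + 2) → Bool) =
      chainWeight p α b * lazyStep p α (b (Fin.last T)) y := by
  have h0 : (Fin.snoc b y : Fin (T + 2) → Bool) 0 = b 0 := by
    rw [← Fin.castSucc_zero, Fin.snoc_castSucc (α := fun _ => Bool)]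
  have h1 (k : Fin (T + 1)) : (Fin.snoc b y : Fin (T + 2) → Bool) k.castSucc = b k :=
    Fin.snoc_castSucc (α := fun _ => Bool) _ _ _
  have h2 : (Fin.snoc b y : Fin (T + 2) → Bool) (Fin.last (T + 1)) = y :=
    Fin.snoc_last (α := fun _ => Bool) _ _
  unfold chainWeight
  rw [Fin.prod_univ_castSucc, h0, Fin.succ_last]
  simp only [h1, h2, Fin.succ_castSucc]
  ring

lemma pathSum_snoc {T : ℕ} (b : Fin (T + 1) → Bool) (y : Bool) :
    pathSum (Fin.snoc b y : Fin (T + 2) → Bool) = pathSum b + if y then 1 else 0 := by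
  unfold pathSum
  rw [Fin.sum_univ_castSucc]
  simp [Fin.snoc_castSucc (α := fun _ => Bool), Fin.snoc_last (α := fun _ => Bool)]

lemma sum_chainWeight_succ (p α : ℝ) {T : ℕ} (F : (Fin (T + 2) → Bool) → ℝ) :
    ∑ b, chainWeight p α b * F b =
      ∑ b : Fin (T + 1) → Bool, chainWeight p α b *
        (lazyStep p α (b (Fin.last T)) true * F (Fin.snoc b true) +
          lazyStep p α (b (Fin.last T)) false * F (Fin.snoc b false)) := by
  rw [← (Fin.snocEquiv (fun _ : Fin (T + 2) => Bool)).sum_comp, Fintype.sum_prod_type,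
    Finset.sum_comm]
  refine Finset.sum_congr rfl fun b _ => ?_
  rw [Fintype.sum_bool]
  change chainWeight p α (Fin.snoc b true : Fin (T + 2) → Bool) * F (Fin.snoc b true) +
    chainWeight p α (Fin.snoc b false : Fin (T + 2) → Bool) * F (Fin.snoc b false) = _
  rw [chainWeight_snoc, chainWeight_snoc]
  ring

lemma sum_chainWeight_zero (p α : ℝ) (F : (Fin 1 → Bool) → ℝ) :
    ∑ b, chainWeight p α b * F b =
      p * F (fun _ => true) + (1 - p) * F (fun _ => false) := by
  rw [← (Equiv.funUnique (Fin 1) Bool).symm.sum_comp, Fintype.sum_bool]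
  simp [chainWeight, bernProb]
  rfl

lemma lazyStep_add (p α : ℝ) (x : Bool) : lazyStep p α x true + lazyStep p α x false = 1 := by
  cases x <;> simp [lazyStep, bernProb] <;> ring

lemma lazyStep_true (p α : ℝ) (x : Bool) :
    lazyStep p α x true = α * (if x then 1 else 0) + (1 - α) * p := by
  cases x <;> simp [lazyStep, bernProb]

lemma bernProb_nonneg {p : ℝ} (hp : p ∈ Set.Icc (0 : ℝ) 1) (x : Bool) : 0 ≤ bernProb p x := by
  obtain ⟨h0, h1⟩ := hp
  cases x <;> simp [bernProb, h0, h1]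

lemma lazyStep_nonneg {p α : ℝ} (hp : p ∈ Set.Icc (0 : ℝ) 1) (hα : α ∈ Set.Ioo (0 : ℝ) 1)
    (x y : Bool) : 0 ≤ lazyStep p α x y := by
  have h1 : 0 ≤ 1 - α := by linarith [hα.2]
  have h2 := mul_nonneg h1 (bernProb_nonneg hp y)
  unfold lazyStep
  split_ifs <;> linarith [hα.1]

lemma chainWeight_nonneg {p α : ℝ} (hp : p ∈ Set.Icc (0 : ℝ) 1) (hα : α ∈ Set.Ioo (0 : ℝ) 1)
    {T : ℕ} (b : Fin (T + 1) → Bool) : 0 ≤ chainWeight p α b :=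
  mul_nonneg (bernProb_nonneg hp _) (Finset.prod_nonneg fun _ _ => lazyStep_nonneg hp hα _ _)

lemma sum_chainWeight (p α : ℝ) (T : ℕ) :
    ∑ b : Fin (T + 1) → Bool, chainWeight p α b = 1 := by
  induction T with
  | zero => simpa using sum_chainWeight_zero p α fun _ => 1
  | succ T ih => simpa [lazyStep_add, ih] using sum_chainWeight_succ p α (T := T) fun _ => 1

lemma sum_chainWeight_last (p α : ℝ) (T : ℕ) :
    ∑ b : Fin (T + 1) → Bool, chainWeight p α b * (if b (Fin.last T) then 1 else 0) = p := by
  induction T with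
  | zero =>
    rw [sum_chainWeight_zero p α fun b : Fin 1 → Bool => if b (Fin.last 0) then (1 : ℝ) else 0]
    simp
  | succ T ih =>
    rw [sum_chainWeight_succ p α
      fun b : Fin (T + 2) → Bool => if b (Fin.last (T + 1)) then (1 : ℝ) else 0]
    simp only [Fin.snoc_last (α := fun _ => Bool), lazyStep_true, mul_add, Finset.sum_add_distrib,
      reduceIte, Bool.false_eq_true, mul_zero, mul_one, add_zero]
    simp only [mul_left_comm _ α, ← Finset.mul_sum, ← Finset.sum_mul, ih, sum_chainWeight]
    ring

lemma sum_chainWeight_pathSum (p α : ℝ) (T : ℕ) :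
    ∑ b : Fin (T + 1) → Bool, chainWeight p α b * pathSum b = (T + 1) * p := by
  induction T with
  | zero => rw [sum_chainWeight_zero]; simp [pathSum]
  | succ T ih =>
    rw [sum_chainWeight_succ]
    have h (b : Fin (T + 1) → Bool) : chainWeight p α b *
        (lazyStep p α (b (Fin.last T)) true * pathSum (Fin.snoc b true : Fin (T + 2) → Bool) +
          lazyStep p α (b (Fin.last T)) false * pathSum (Fin.snoc b false : Fin (T + 2) → Bool)) =
        chainWeight p α b * pathSum b +
          α * (chainWeight p α b * (if b (Fin.last T) then 1 else 0)) +
          (1 - α) * p * chainWeight p α b := by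
      have h1 := lazyStep_add p α (b (Fin.last T))
      rw [← eq_sub_iff_add_eq'] at h1
      rw [pathSum_snoc, pathSum_snoc, h1, lazyStep_true]
      cases b (Fin.last T) <;> simp <;> ring
    rw [Finset.sum_congr rfl fun b _ => h b]
    simp only [Finset.sum_add_distrib, ← Finset.mul_sum, ih, sum_chainWeight_last, sum_chainWeight]
    push_cast
    ring

/-- Exponential moment of the number of `true` states of the lazy Bernoulli chain. -/
def chainMGF (p α : ℝ) (T : ℕ) (θ : ℝ) : ℝ :=
  ∑ b : Fin (T + 1) → Bool, chainWeight p α b * rexp (θ * pathSum b)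

/-- Exponential moment restricted to the trajectories that end in the state `true`. -/
def chainMGFLast (p α : ℝ) (T : ℕ) (θ : ℝ) : ℝ :=
  ∑ b : Fin (T + 1) → Bool, chainWeight p α b *
    (rexp (θ * pathSum b) * if b (Fin.last T) then 1 else 0)

lemma chainMGFLast_succ (p α : ℝ) (T : ℕ) (θ : ℝ) :
    chainMGFLast p α (T + 1) θ =
      rexp θ * (α * chainMGFLast p α T θ + (1 - α) * p * chainMGF p α T θ) := by
  unfold chainMGFLast chainMGF
  rw [sum_chainWeight_succ p α (fun b : Fin (T + 2) → Bool =>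
    rexp (θ * pathSum b) * if b (Fin.last (T + 1)) then (1 : ℝ) else 0)]
  simp only [Fin.snoc_last (α := fun _ => Bool), lazyStep_true, pathSum_snoc, Finset.mul_sum,
    ← Finset.sum_add_distrib, mul_add, Real.exp_add]
  refine Finset.sum_congr rfl fun b _ => ?_
  cases b (Fin.last T) <;> simp <;> ring

lemma chainMGF_succ (p α : ℝ) (T : ℕ) (θ : ℝ) :
    chainMGF p α (T + 1) θ = chainMGF p α T θ +
      (rexp θ - 1) * (α * chainMGFLast p α T θ + (1 - α) * p * chainMGF p α T θ) := by
  unfold chainMGFLast chainMGF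
  rw [sum_chainWeight_succ]
  simp only [pathSum_snoc, Finset.mul_sum, ← Finset.sum_add_distrib, mul_add, Real.exp_add]
  refine Finset.sum_congr rfl fun b _ => ?_
  have h1 := lazyStep_add p α (b (Fin.last T))
  rw [← eq_sub_iff_add_eq'] at h1
  rw [h1, lazyStep_true]
  cases b (Fin.last T) <;> simp <;> ring

lemma chainMGF_nonneg {p α : ℝ} (hp : p ∈ Set.Icc (0 : ℝ) 1) (hα : α ∈ Set.Ioo (0 : ℝ) 1)
    (T : ℕ) (θ : ℝ) : 0 ≤ chainMGF p α T θ :=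
  Finset.sum_nonneg fun b _ => mul_nonneg (chainWeight_nonneg hp hα b) (Real.exp_pos _).le

/-- The exponential moment of the chain is at most that of a Poisson-like variable whose jumps
have been lengthened by the laziness. -/
lemma chainMGF_le {p α θ κ : ℝ} (hp : p ∈ Set.Icc (0 : ℝ) 1) (hα : α ∈ Set.Ioo (0 : ℝ) 1)
    (hθ : α * rexp θ < 1) (hκ : κ = rexp θ * (1 - α) / (1 - α * rexp θ)) (T : ℕ) :
    chainMGF p α T θ ≤ rexp ((T + 1) * (p * ((rexp θ - 1) * (α * κ + (1 - α))))) := by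
  have hD : 0 < 1 - α * rexp θ := by linarith
  have hD' := hD.ne'
  have hκ1 : rexp θ * (α * κ + (1 - α)) = κ := by
    rw [hκ, eq_div_iff hD']
    linear_combination rexp θ * α * div_mul_cancel₀ (rexp θ * (1 - α)) hD'
  have hα1 : 0 < 1 - α := by linarith [hα.2]
  have hκ0 : 0 < κ := by rw [hκ]; positivity
  have hα0 := hα.1
  have hp0 := hp.1
  set s := α * κ + (1 - α) with hs
  have hs0 : 0 < s := by positivity
  have hbase : chainMGF p α 0 θ = 1 + (rexp θ - 1) * p := by
    unfold chainMGF; rw [sum_chainWeight_zero]; simp [pathSum]; ring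
  have hcomp : ∀ T, (rexp θ - 1) * chainMGFLast p α T θ ≤
      (rexp θ - 1) * (κ * p * chainMGF p α T θ) := by
    intro T
    have hbaseL : chainMGFLast p α 0 θ = rexp θ * p := by
      unfold chainMGFLast
      rw [sum_chainWeight_zero p α (fun b : Fin 1 → Bool =>
        rexp (θ * pathSum b) * if b (Fin.last 0) then (1 : ℝ) else 0)]
      simp [pathSum]; ring
    rcases le_total 0 (rexp θ - 1) with h | h
    · refine mul_le_mul_of_nonneg_left ?_ h
      induction T with
      | zero =>
        rw [hbase, hbaseL]
        have : rexp θ ≤ κ := by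
          rw [hκ, le_div_iff₀ hD]
          nlinarith [Real.exp_pos θ, mul_nonneg hα0.le h]
        have h3 : 0 ≤ κ * p * ((rexp θ - 1) * p) := by positivity
        nlinarith
      | succ T ih =>
        have hu := chainMGF_nonneg hp hα T θ
        have hle : α * chainMGFLast p α T θ + (1 - α) * p * chainMGF p α T θ ≤
            s * (p * chainMGF p α T θ) := by
          have := mul_le_mul_of_nonneg_left ih hα0.le
          rw [hs]; linarith
        have h1 : 0 ≤ chainMGFLast p α T θ := Finset.sum_nonneg fun b _ =>
          mul_nonneg (chainWeight_nonneg hp hα b) (by positivity)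
        have h2 : chainMGF p α T θ ≤ chainMGF p α (T + 1) θ := by
          rw [chainMGF_succ]
          have : 0 ≤ (rexp θ - 1) *
            (α * chainMGFLast p α T θ + (1 - α) * p * chainMGF p α T θ) := by positivity
          linarith
        rw [chainMGFLast_succ]
        calc _ ≤ rexp θ * (s * (p * chainMGF p α T θ)) := by gcongr
          _ = κ * p * chainMGF p α T θ := by rw [← mul_assoc, hκ1]; ring
          _ ≤ _ := by gcongr
    · refine mul_le_mul_of_nonpos_left ?_ h
      induction T with
      | zero =>
        rw [hbase, hbaseL]
        have : κ ≤ rexp θ := by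
          rw [hκ, div_le_iff₀ hD]
          nlinarith [Real.exp_pos θ, mul_nonneg hα0.le (neg_nonneg.2 h)]
        have h3 : 0 ≤ κ * p * (-(rexp θ - 1) * p) := by
          have := neg_nonneg.2 h
          positivity
        nlinarith
      | succ T ih =>
        have hu := chainMGF_nonneg hp hα T θ
        have hle : s * (p * chainMGF p α T θ) ≤
            α * chainMGFLast p α T θ + (1 - α) * p * chainMGF p α T θ := by
          have := mul_le_mul_of_nonneg_left ih hα0.le
          rw [hs]; linarith
        have h1 : 0 ≤ chainMGFLast p α T θ := Finset.sum_nonneg fun b _ =>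
          mul_nonneg (chainWeight_nonneg hp hα b) (by positivity)
        have h2 : chainMGF p α (T + 1) θ ≤ chainMGF p α T θ := by
          rw [chainMGF_succ]
          have : (rexp θ - 1) *
            (α * chainMGFLast p α T θ + (1 - α) * p * chainMGF p α T θ) ≤ 0 :=
            mul_nonpos_of_nonpos_of_nonneg h (by positivity)
          linarith
        rw [chainMGFLast_succ]
        calc _ ≤ κ * p * chainMGF p α T θ := by gcongr
          _ = rexp θ * (s * (p * chainMGF p α T θ)) := by rw [← mul_assoc (rexp θ), hκ1]; ring
          _ ≤ _ := by gcongr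
  induction T with
  | zero =>
    have : (rexp θ - 1) * 1 ≤ (rexp θ - 1) * s := by
      have h1 : κ - 1 = (rexp θ - 1) / (1 - α * rexp θ) := by
        rw [hκ, div_sub_one hD']; ring
      have h2 : (rexp θ - 1) * s - (rexp θ - 1) * 1 =
          α * ((rexp θ - 1) ^ 2 / (1 - α * rexp θ)) := by
        rw [hs]
        linear_combination (rexp θ - 1) * α * h1
      have h3 : 0 ≤ α * ((rexp θ - 1) ^ 2 / (1 - α * rexp θ)) := by positivity
      linarith
    rw [hbase]
    have h4 := Real.add_one_le_exp (((0 : ℕ) + 1) * (p * ((rexp θ - 1) * s)))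
    refine le_trans ?_ h4
    push_cast
    nlinarith
  | succ T ih =>
    have hu := chainMGF_nonneg hp hα T θ
    have h1 := mul_le_mul_of_nonneg_left (hcomp T) hα0.le
    calc chainMGF p α (T + 1) θ
        ≤ chainMGF p α T θ * (p * ((rexp θ - 1) * s) + 1) := by
          rw [chainMGF_succ, hs]; linarith
      _ ≤ chainMGF p α T θ * rexp (p * ((rexp θ - 1) * s)) := by
          gcongr; exact Real.add_one_le_exp _
      _ ≤ rexp ((T + 1) * (p * ((rexp θ - 1) * s))) * rexp (p * ((rexp θ - 1) * s)) := by
          gcongr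
      _ = _ := by rw [← Real.exp_add]; push_cast; ring_nf

lemma exists_subexponential_rate {α : ℝ} (hα : α ∈ Set.Ioo (0 : ℝ) 1) :
    ∃ θ₀ : ℝ, 0 < θ₀ ∧ θ₀ ≤ 1 ∧ ∃ L : ℝ, 0 < L ∧ ∀ p ∈ Set.Icc (0 : ℝ) 1, ∀ (T : ℕ) (θ : ℝ),
      |θ| ≤ θ₀ → ∑ b : Fin (T + 1) → Bool, chainWeight p α b *
        rexp (θ * (pathSum b - (T + 1) * p)) ≤ rexp (L * ((T + 1) * p) * θ ^ 2) := by
  obtain ⟨h0, h1⟩ := hα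
  have hα1 : 0 < 1 - α := by linarith
  refine ⟨(1 - α) / 4, by positivity, by linarith, 1 + 8 / (1 - α), by positivity, ?_⟩
  intro p hp T θ hθ
  have hθ1 : |θ| ≤ 1 := by linarith
  have hz1 := Real.abs_exp_sub_one_le hθ1
  have hz2 := Real.abs_exp_sub_one_sub_id_le hθ1
  set z := rexp θ - 1 with hz
  have hE : rexp θ = 1 + z := by rw [hz]; ring
  have hz3 : z ≤ (1 - α) / 2 := (le_abs_self z).trans (by linarith)
  have hzα : α * z ≤ (1 - α) / 2 := by
    rcases le_total 0 z with h | h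
    · nlinarith
    · nlinarith [mul_nonpos_of_nonneg_of_nonpos h0.le h]
  have hD : (1 - α) / 2 ≤ 1 - α * rexp θ := by rw [hE]; linarith
  have hD0 : 0 < 1 - α * rexp θ := by linarith
  have hM := chainMGF_le hp ⟨h0, h1⟩ (by linarith) rfl T
  have hsum : ∑ b : Fin (T + 1) → Bool, chainWeight p α b *
      rexp (θ * (pathSum b - (T + 1) * p)) =
      rexp (-(θ * ((T + 1) * p))) * chainMGF p α T θ := by
    unfold chainMGF
    rw [Finset.mul_sum]
    refine Finset.sum_congr rfl fun b _ => ?_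
    rw [mul_sub, sub_eq_add_neg, Real.exp_add]
    ring
  rw [hsum]
  refine (mul_le_mul_of_nonneg_left hM (Real.exp_pos _).le).trans ?_
  rw [← Real.exp_add]
  refine Real.exp_le_exp.2 ?_
  have hκ : (rexp θ - 1) * (α * (rexp θ * (1 - α) / (1 - α * rexp θ)) + (1 - α)) =
      z + α * (z ^ 2 / (1 - α * rexp θ)) := by
    rw [hE] at hD0 ⊢
    simp only [div_eq_mul_inv]
    linear_combination z * α * mul_inv_cancel₀ hD0.ne'
  rw [hκ]
  have hzz : z ^ 2 ≤ 4 * θ ^ 2 := by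
    have := sq_le_sq' (by linarith [abs_nonneg z, abs_nonneg θ]) hz1
    rw [sq_abs] at this
    nlinarith [sq_abs θ]
  have h5 : α * (z ^ 2 / (1 - α * rexp θ)) ≤ 8 / (1 - α) * θ ^ 2 := by
    calc _ ≤ 1 * (4 * θ ^ 2 / ((1 - α) / 2)) := by gcongr
      _ = _ := by field_simp; ring
  have h6 : z ≤ θ + θ ^ 2 := by linarith [le_abs_self (z - θ)]
  have hq : 0 ≤ ((T : ℝ) + 1) * p := mul_nonneg (by positivity) hp.1
  have h7 : ((T : ℝ) + 1) * p * (z + α * (z ^ 2 / (1 - α * rexp θ))) ≤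
      (T + 1) * p * (θ + θ ^ 2 + 8 / (1 - α) * θ ^ 2) := by gcongr
  linarith

lemma abs_pow_div_factorial_le (y : ℝ) {m : ℕ} (hm : 2 ≤ m) :
    |y| ^ m / m.factorial ≤ rexp y + rexp (-y) - 2 := by
  have h1 : 1 + |y| + |y| ^ m / m.factorial ≤ rexp |y| := by
    refine le_trans ?_ (Real.sum_le_exp_of_nonneg (abs_nonneg y) (m + 1))
    rw [Finset.sum_range_succ]
    refine add_le_add_left ?_ _
    refine le_trans (le_of_eq ?_) (Finset.sum_le_sum_of_subset_of_nonneg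
      (Finset.range_mono hm) fun i _ _ => by positivity)
    simp [Finset.sum_range_succ]
  have h2 := Real.one_sub_le_exp_neg |y|
  have h3 : rexp y + rexp (-y) = rexp |y| + rexp (-|y|) := by
    rcases abs_cases y with ⟨h, _⟩ | ⟨h, _⟩ <;> rw [h]
    rw [neg_neg, add_comm]
  linarith

lemma factorial_mul_pow_le_prod {a q r : ℝ} (ha : 0 < a) (hq : 0 ≤ q) (h : 0 ≤ r)
    {m : ℕ} (hr : r ^ 2 * m = q + m) (k : ℕ) (hk : k + 2 ≤ m) :
    q * ((k + 2).factorial * r ^ k) ≤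
      ∏ s ∈ Finset.range (k + 2), (a * q + 2 * s * (a + a⁻¹)) := by
  have hai : a * a⁻¹ = 1 := mul_inv_cancel₀ ha.ne'
  have hi : 0 < a⁻¹ := inv_pos.2 ha
  induction k with
  | zero =>
    have : 0 ≤ (a * q) * (a * q + 2 * a) := by positivity
    simp only [Finset.prod_range_succ, Finset.prod_range_zero]
    norm_num
    linear_combination this - (2 * q) * hai
  | succ k ih =>
    rw [Finset.prod_range_succ, Nat.factorial_succ, pow_succ]
    have hm : (0 : ℝ) < m := by
      have : 0 < m := by omega
      exact_mod_cast this
    have hkm : ((k : ℝ) + 3) ≤ m := by exact_mod_cast hk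
    have hstep : ((k : ℝ) + 3) * r ≤ a * q + 2 * ((k + 2 : ℕ) : ℝ) * (a + a⁻¹) := by
      have h1 : ((k : ℝ) + 3) * r ^ 2 ≤ q + (k + 3) := by
        refine le_of_mul_le_mul_right ?_ hm
        rw [mul_assoc, hr]
        nlinarith
      have h2 : 2 * r ≤ a * r ^ 2 + a⁻¹ := by
        have : 0 ≤ a * (r - a⁻¹) ^ 2 := by positivity
        linear_combination this - (2 * r - a⁻¹) * hai
      have h3 : a * (((k : ℝ) + 3) * r ^ 2) ≤ a * (q + (k + 3)) := by gcongr
      have h4 : ((k : ℝ) + 3) * (2 * r) ≤ (k + 3) * (a * r ^ 2 + a⁻¹) := by gcongr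
      have h5 : 0 ≤ (k : ℝ) * (a + a⁻¹) := by positivity
      have h6 : ((k : ℝ) + 3) * r ≤ (k + 3) * (a * r ^ 2 + a⁻¹) := by
        have : 0 ≤ ((k : ℝ) + 3) * r := by positivity
        linarith
      push_cast
      nlinarith
    have h0 : 0 ≤ a * q + 2 * ((k + 2 : ℕ) : ℝ) * (a + a⁻¹) := by positivity
    have hprod : 0 ≤ ∏ s ∈ Finset.range (k + 2), (a * q + 2 * (s : ℝ) * (a + a⁻¹)) :=
      Finset.prod_nonneg fun s _ => by positivity
    calc q * (((k + 1 + 1 + 1) * (k + 2).factorial : ℕ) * (r ^ k * r))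
        = q * ((k + 2).factorial * r ^ k) * ((k + 3) * r) := by push_cast; ring
      _ ≤ _ := mul_le_mul (ih (by omega)) hstep (by positivity) hprod

/-- Central moments of the number of `true` states of the lazy Bernoulli chain, bounded by
Poisson-like products that are multiplicative in the order of the moment. -/
lemma exists_moment_bound {α : ℝ} (hα : α ∈ Set.Ioo (0 : ℝ) 1) :
    ∃ K : ℝ, 0 < K ∧ ∀ p ∈ Set.Icc (0 : ℝ) 1, ∀ T : ℕ, ∀ a : ℝ, 0 < a → ∀ m : ℕ,
      |∑ b : Fin (T + 1) → Bool, chainWeight p α b * (pathSum b - (T + 1) * p) ^ m| ≤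
        K ^ m * ∏ s ∈ Finset.range m, (a * ((T + 1) * p) + 2 * s * (a + a⁻¹)) := by
  obtain ⟨θ₀, hθ₀, hθ₁, L, hL, hmgf⟩ := exists_subexponential_rate hα
  refine ⟨(1 + 2 * L) * rexp L * θ₀⁻¹, by positivity, fun p hp T a ha m => ?_⟩
  set q : ℝ := (T + 1) * p with hq
  have hq0 : 0 ≤ q := mul_nonneg (by positivity) hp.1
  match m with
  | 0 => simp [sum_chainWeight]
  | 1 =>
    have : ∑ b : Fin (T + 1) → Bool, chainWeight p α b * (pathSum b - q) ^ 1 = 0 := by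
      simp only [pow_one, mul_sub, Finset.sum_sub_distrib, ← Finset.sum_mul,
        sum_chainWeight_pathSum, sum_chainWeight]
      simp [hq]
    rw [this, abs_zero]
    simp only [Finset.prod_range_one]
    positivity
  | k + 2 =>
    have hm : (0 : ℝ) < ((k + 2 : ℕ) : ℝ) := by positivity
    set m : ℝ := ((k + 2 : ℕ) : ℝ) with hmdef
    set r := √((q + m) / m) with hrdef
    have hr0 : 0 < r := Real.sqrt_pos.2 (by positivity)
    have hr2 : r ^ 2 * m = q + m := by
      rw [hrdef, Real.sq_sqrt (by positivity)]
      field_simp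
    have hr1 : 1 ≤ r := by
      rw [hrdef, Real.one_le_sqrt, le_div_iff₀ hm]
      linarith
    set θ := θ₀ / r with hθ
    have hθpos : 0 < θ := by positivity
    have hθle : θ ≤ θ₀ := div_le_self hθ₀.le hr1
    have hu : L * q * θ ^ 2 ≤ L * m := by
      have h1 : q * θ ^ 2 ≤ m := by
        rw [hθ, div_pow, mul_div_assoc', div_le_iff₀ (by positivity)]
        have : θ₀ ^ 2 ≤ 1 := pow_le_one₀ hθ₀.le hθ₁
        nlinarith
      rw [mul_assoc]
      gcongr
    have hexp : rexp (L * q * θ ^ 2) - 1 ≤ L * q * θ ^ 2 * rexp (L * m) := by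
      have h1 := Real.one_sub_le_exp_neg (L * q * θ ^ 2)
      have h2 : rexp (L * q * θ ^ 2) * rexp (-(L * q * θ ^ 2)) = 1 := by
        rw [← Real.exp_add, add_neg_cancel, Real.exp_zero]
      have h3 : rexp (L * q * θ ^ 2) ≤ rexp (L * m) := Real.exp_le_exp.2 hu
      have h4 : 0 ≤ L * q * θ ^ 2 := by positivity
      nlinarith [Real.exp_pos (L * q * θ ^ 2), mul_le_mul_of_nonneg_left h3 h4]
    have hplus := hmgf p hp T θ (by rwa [abs_of_pos hθpos])
    have hminus := hmgf p hp T (-θ) (by rwa [abs_neg, abs_of_pos hθpos])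
    rw [neg_sq] at hminus
    have hsum : ∑ b : Fin (T + 1) → Bool,
        chainWeight p α b * (|θ * (pathSum b - q)| ^ (k + 2) / (k + 2).factorial) ≤
        2 * (L * q * θ ^ 2 * rexp (L * m)) := by
      calc _ ≤ ∑ b : Fin (T + 1) → Bool, chainWeight p α b *
            (rexp (θ * (pathSum b - q)) + rexp (-θ * (pathSum b - q)) - 2) := by
            refine Finset.sum_le_sum fun b _ =>
              mul_le_mul_of_nonneg_left ?_ (chainWeight_nonneg hp hα b)
            rw [neg_mul]
            exact abs_pow_div_factorial_le _ (by omega)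
        _ = ∑ b : Fin (T + 1) → Bool, chainWeight p α b * rexp (θ * (pathSum b - q)) +
            ∑ b : Fin (T + 1) → Bool, chainWeight p α b * rexp (-θ * (pathSum b - q)) - 2 := by
            simp only [mul_sub, mul_add, Finset.sum_sub_distrib, Finset.sum_add_distrib,
              ← Finset.sum_mul, sum_chainWeight, one_mul]
        _ ≤ _ := by linarith
    have hprod := factorial_mul_pow_le_prod ha hq0 hr0.le hr2 k le_rfl
    set Q := ∏ s ∈ Finset.range (k + 2), (a * q + 2 * (s : ℝ) * (a + a⁻¹)) with hQ
    have hQ0 : 0 ≤ Q := le_trans (by positivity) hprod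
    calc |∑ b : Fin (T + 1) → Bool, chainWeight p α b * (pathSum b - q) ^ (k + 2)|
        ≤ ∑ b : Fin (T + 1) → Bool, chainWeight p α b * |pathSum b - q| ^ (k + 2) := by
          refine (Finset.abs_sum_le_sum_abs _ _).trans (le_of_eq ?_)
          simp_rw [abs_mul, abs_pow, abs_of_nonneg (chainWeight_nonneg hp hα _)]
      _ = (k + 2).factorial * (θ ^ (k + 2))⁻¹ * ∑ b : Fin (T + 1) → Bool,
          chainWeight p α b * (|θ * (pathSum b - q)| ^ (k + 2) / (k + 2).factorial) := by
          rw [Finset.mul_sum]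
          refine Finset.sum_congr rfl fun b _ => ?_
          rw [abs_mul, abs_of_pos hθpos, mul_pow]
          have : ((k + 2).factorial : ℝ) ≠ 0 := by positivity
          field_simp
      _ ≤ (k + 2).factorial * (θ ^ (k + 2))⁻¹ * (2 * (L * q * θ ^ 2 * rexp (L * m))) := by
          gcongr
      _ = 2 * L * rexp (L * m) * (θ₀⁻¹) ^ k * (q * ((k + 2).factorial * r ^ k)) := by
          have : θ₀⁻¹ = (θ * r)⁻¹ := by rw [hθ, div_mul_cancel₀ _ hr0.ne']
          rw [this, pow_add, inv_pow, mul_pow]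
          have hθ' := hθpos.ne'
          have hr' := hr0.ne'
          clear_value θ r
          field_simp
      _ ≤ 2 * L * rexp (L * m) * (θ₀⁻¹) ^ k * Q := by gcongr
      _ ≤ ((1 + 2 * L) ^ (k + 2) * rexp (L * m) * (θ₀⁻¹) ^ (k + 2)) * Q := by
          have h1 : 2 * L ≤ (1 + 2 * L) ^ (k + 2) := by
            have := le_self_pow₀ (by linarith : 1 ≤ 1 + 2 * L) (show k + 2 ≠ 0 by omega)
            linarith
          have h2 : (θ₀⁻¹) ^ k ≤ (θ₀⁻¹) ^ (k + 2) :=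
            pow_le_pow_right₀ ((one_le_inv₀ hθ₀).2 hθ₁) (by omega)
          gcongr
      _ = ((1 + 2 * L) * rexp L * θ₀⁻¹) ^ (k + 2) * Q := by
          rw [mul_pow, mul_pow, ← Real.exp_nat_mul, mul_comm L]

section Walk

variable {ι E S : Type*} [Fintype ι] [Fintype E] [DecidableEq E] [Fintype S]

/-- Expectation of `F` under the product of the weights `ν e`. -/
def prodExp (ν : E → S → ℝ) (F : (E → S) → ℝ) : ℝ := ∑ τ : E → S, (∏ e, ν e (τ e)) * F τ

lemma prodExp_sum {κ : Type*} (s : Finset κ) (ν : E → S → ℝ) (F : κ → (E → S) → ℝ) :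
    prodExp ν (fun τ => ∑ k ∈ s, F k τ) = ∑ k ∈ s, prodExp ν (F k) := by
  simp only [prodExp, Finset.mul_sum]
  exact Finset.sum_comm

lemma prodExp_prod (ν : E → S → ℝ) (f : E → S → ℝ) :
    prodExp ν (fun τ => ∏ e, f e (τ e)) = ∏ e, ∑ b, ν e b * f e b := by
  simp only [prodExp, ← Finset.prod_mul_distrib]
  rw [Finset.prod_univ_sum, Fintype.piFinset_univ]

/-- Moments of powers of a random matrix with independent entries, up to the identification of
entries by `edge`, grow at most like powers of the row sums of the moment ratios. -/
lemma abs_prodExp_pow_le [DecidableEq ι] (ν x : E → S → ℝ) (edge : ι → ι → E) (w : E → ℕ → ℝ)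
    {K B : ℝ} (hK : 0 ≤ K) (hw : ∀ e s, 0 ≤ w e s)
    (hmom : ∀ e m, |∑ b, ν e b * x e b ^ m| ≤ K ^ m * ∏ s ∈ Finset.range m, w e s) (M : ℕ)
    (hrow : ∀ m : E → ℕ, ∑ e, m e ≤ M → ∀ i, ∑ k, w (edge i k) (m (edge i k)) ≤ B)
    (N : ℕ) (m : E → ℕ) (hm : ∑ e, m e + N ≤ M) (i j : ι) :
    |prodExp ν fun τ => (∏ e, x e (τ e) ^ m e) *
        ((Matrix.of fun i j => x (edge i j) (τ (edge i j)) : Matrix ι ι ℝ) ^ N) i j| ≤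
      K ^ (∑ e, m e + N) * (∏ e, ∏ s ∈ Finset.range (m e), w e s) * B ^ N := by
  induction N generalizing m i with
  | zero =>
    simp only [pow_zero, add_zero, mul_one]
    have hnn : 0 ≤ K ^ (∑ e, m e) * ∏ e, ∏ s ∈ Finset.range (m e), w e s :=
      mul_nonneg (pow_nonneg hK _)
        (Finset.prod_nonneg fun e _ => Finset.prod_nonneg fun s _ => hw e s)
    rcases eq_or_ne i j with rfl | hij
    · simp only [Matrix.one_apply_eq, mul_one]
      rw [prodExp_prod ν (fun e b => x e b ^ m e), Finset.abs_prod, ← Finset.prod_pow_eq_pow_sum,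
        ← Finset.prod_mul_distrib]
      exact Finset.prod_le_prod (fun _ _ => abs_nonneg _) fun e _ => hmom e (m e)
    · simpa [Matrix.one_apply_ne hij, prodExp] using hnn
  | succ N ih =>
    have hcomb (k : ι) (τ : E → S) : (∏ e, x e (τ e) ^ (m + Pi.single (edge i k) 1 : E → ℕ) e) =
        (∏ e, x e (τ e) ^ m e) * x (edge i k) (τ (edge i k)) := by
      simp only [Pi.add_apply, pow_add, Finset.prod_mul_distrib]
      congr 1
      rw [Finset.prod_eq_single (edge i k)]
      · simp
      · intro e _ he
        simp [Pi.single_eq_of_ne he]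
      · simp
    have hsum (k : ι) : ∑ e, (m + Pi.single (edge i k) 1 : E → ℕ) e = ∑ e, m e + 1 := by
      simp [Finset.sum_add_distrib]
    have hw' (k : ι) : ∏ e, ∏ s ∈ Finset.range ((m + Pi.single (edge i k) 1 : E → ℕ) e), w e s =
        (∏ e, ∏ s ∈ Finset.range (m e), w e s) * w (edge i k) (m (edge i k)) := by
      rw [← Finset.mul_prod_erase _ _ (Finset.mem_univ (edge i k)),
        ← Finset.mul_prod_erase (a := edge i k) _
          (fun e => ∏ s ∈ Finset.range (m e), w e s) (Finset.mem_univ _)]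
      have : ∏ e ∈ Finset.univ.erase (edge i k),
          ∏ s ∈ Finset.range ((m + Pi.single (edge i k) 1 : E → ℕ) e), w e s =
          ∏ e ∈ Finset.univ.erase (edge i k), ∏ s ∈ Finset.range (m e), w e s := by
        refine Finset.prod_congr rfl fun e he => ?_
        simp [Pi.single_eq_of_ne (Finset.ne_of_mem_erase he)]
      rw [this]
      simp only [Pi.add_apply, Pi.single_eq_same, Finset.prod_range_succ]
      ring
    have hexpand : (prodExp ν fun τ => (∏ e, x e (τ e) ^ m e) *
        ((Matrix.of fun i j => x (edge i j) (τ (edge i j)) : Matrix ι ι ℝ) ^ (N + 1)) i j) =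
        ∑ k, prodExp ν fun τ => (∏ e, x e (τ e) ^ (m + Pi.single (edge i k) 1 : E → ℕ) e) *
          ((Matrix.of fun i j => x (edge i j) (τ (edge i j)) : Matrix ι ι ℝ) ^ N) k j := by
      rw [← prodExp_sum]
      congr 1
      funext τ
      rw [pow_succ', Matrix.mul_apply, Finset.mul_sum]
      refine Finset.sum_congr rfl fun k _ => ?_
      rw [hcomb, Matrix.of_apply, mul_assoc]
    rw [hexpand]
    have hB : 0 ≤ B := (Finset.sum_nonneg fun k _ => hw _ _).trans (hrow m (by omega) i)
    have hP : 0 ≤ ∏ e, ∏ s ∈ Finset.range (m e), w e s :=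
      Finset.prod_nonneg fun e _ => Finset.prod_nonneg fun s _ => hw e s
    calc _ ≤ ∑ k, |prodExp ν fun τ => (∏ e, x e (τ e) ^ (m + Pi.single (edge i k) 1 : E → ℕ) e) *
          ((Matrix.of fun i j => x (edge i j) (τ (edge i j)) : Matrix ι ι ℝ) ^ N) k j| :=
          Finset.abs_sum_le_sum_abs _ _
      _ ≤ ∑ k, K ^ (∑ e, m e + (N + 1)) * ((∏ e, ∏ s ∈ Finset.range (m e), w e s) *
          w (edge i k) (m (edge i k))) * B ^ N := by
          refine Finset.sum_le_sum fun k _ => ?_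
          refine (ih _ (by rw [hsum]; omega) k).trans (le_of_eq ?_)
          rw [hsum, hw', add_assoc, add_comm 1 N]
      _ = K ^ (∑ e, m e + (N + 1)) * (∏ e, ∏ s ∈ Finset.range (m e), w e s) *
          (∑ k, w (edge i k) (m (edge i k))) * B ^ N := by
          rw [← Finset.sum_mul, ← Finset.mul_sum, ← Finset.mul_sum]
          ring
      _ ≤ K ^ (∑ e, m e + (N + 1)) * (∏ e, ∏ s ∈ Finset.range (m e), w e s) * B * B ^ N := by
          gcongr
          exact hrow m (by omega) i
      _ = _ := by rw [pow_succ' B]; ring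

lemma prodExp_trace_pow_le [DecidableEq ι] (ν x : E → S → ℝ) (edge : ι → ι → E)
    (hinj : ∀ i, Function.Injective (edge i)) (q : E → ℝ) (hq : ∀ e, 0 ≤ q e) {K σ : ℝ}
    (hK : 0 ≤ K) (hσ : ∀ i, ∑ k, q (edge i k) ≤ σ)
    (hmom : ∀ a : ℝ, 0 < a → ∀ e m, |∑ b, ν e b * x e b ^ m| ≤
      K ^ m * ∏ s ∈ Finset.range m, (a * q e + 2 * s * (a + a⁻¹)))
    {N : ℕ} (hN : 0 < N) (hNσ : (N : ℝ) ≤ σ) :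
    (prodExp ν fun τ =>
        ((Matrix.of fun i j => x (edge i j) (τ (edge i j)) : Matrix ι ι ℝ) ^ N).trace) ≤
      Fintype.card ι * (K * (5 * √(N * σ))) ^ N := by
  have hN' : (0 : ℝ) < N := by exact_mod_cast hN
  have hσ0 : 0 < σ := hN'.trans_le hNσ
  set R := √(N * σ) with hR
  have hR0 : 0 < R := Real.sqrt_pos.2 (by positivity)
  have hR2 : R * R = N * σ := Real.mul_self_sqrt (by positivity)
  have hNR : (N : ℝ) ≤ R := by nlinarith
  set a := R / σ with ha
  have ha0 : 0 < a := by positivity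
  have haσ : a * σ = R := div_mul_cancel₀ _ hσ0.ne'
  have haN : a⁻¹ * N = R := by
    rw [ha, inv_div, div_mul_eq_mul_div, div_eq_iff hR0.ne', hR2, mul_comm]
  have ha1 : a * N ≤ R := by
    have : a ≤ 1 := by
      rw [ha, div_le_one hσ0]
      nlinarith
    nlinarith
  have hrow : ∀ m : E → ℕ, ∑ e, m e ≤ N → ∀ i,
      ∑ k, (a * q (edge i k) + 2 * (m (edge i k) : ℝ) * (a + a⁻¹)) ≤ 5 * R := by
    intro m hm i
    have h1 : ∑ k, (m (edge i k) : ℝ) ≤ N := by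
      have : ∑ k, m (edge i k) ≤ ∑ e, m e := by
        rw [← Finset.sum_image (g := edge i) (f := m) fun _ _ _ _ h => hinj i h]
        exact Finset.sum_le_sum_of_subset (Finset.subset_univ _)
      exact_mod_cast this.trans hm
    rw [Finset.sum_add_distrib, ← Finset.mul_sum, ← Finset.sum_mul, ← Finset.mul_sum]
    have h2 : a * ∑ k, q (edge i k) ≤ a * σ := by gcongr; exact hσ i
    have h3 : 2 * (∑ k, (m (edge i k) : ℝ)) * (a + a⁻¹) ≤ 2 * N * (a + a⁻¹) := by gcongr
    linarith
  have hwalk (i : ι) := abs_prodExp_pow_le ν x edge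
    (fun e s => a * q e + 2 * (s : ℝ) * (a + a⁻¹)) hK
    (fun e s => by have := hq e; positivity) (hmom a ha0) N hrow N 0 (by simp) i i
  simp only [Pi.zero_apply, pow_zero, Finset.prod_const_one, one_mul, Finset.sum_const_zero,
    zero_add, Finset.range_zero, Finset.prod_empty, mul_one] at hwalk
  simp only [Matrix.trace, Matrix.diag_apply]
  rw [prodExp_sum]
  calc _ ≤ ∑ _i : ι, K ^ N * (5 * R) ^ N :=
        Finset.sum_le_sum fun i _ => (le_abs_self _).trans (hwalk i)
    _ = _ := by simp [mul_pow]

end Walk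

section Norm

open scoped Matrix.Norms.L2Operator

lemma opNorm_eq_norm {n : ℕ} (X : Matrix (Fin n) (Fin n) ℝ) : opNorm X = ‖X‖ := rfl

lemma norm_sq_le_trace {ι : Type*} [Fintype ι] [DecidableEq ι] (Z : Matrix ι ι ℝ) :
    ‖Z‖ ^ 2 ≤ (Z.transpose * Z).trace := by
  have htr : (Z.transpose * Z).trace = ∑ i, ∑ j, Z i j ^ 2 := by
    simp only [Matrix.trace, Matrix.diag_apply, Matrix.mul_apply, Matrix.transpose_apply, pow_two]
    exact Finset.sum_comm
  have h0 : 0 ≤ ∑ i, ∑ j, Z i j ^ 2 := by positivity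
  rw [htr]
  refine (Real.le_sqrt (norm_nonneg _) h0).1 ?_
  rw [Matrix.l2_opNorm_def]
  refine ContinuousLinearMap.opNorm_le_bound _ (Real.sqrt_nonneg _) fun x => ?_
  rw [EuclideanSpace.norm_eq, EuclideanSpace.norm_eq, ← Real.sqrt_mul h0]
  refine Real.sqrt_le_sqrt ?_
  rw [Finset.sum_mul]
  refine Finset.sum_le_sum fun i _ => ?_
  simp only [Real.norm_eq_abs, sq_abs]
  exact Finset.sum_mul_sq_le_sq_mul_sq Finset.univ (Z i) x

/-- The operator norm of a symmetric matrix is controlled by the traces of its dyadic powers. -/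
lemma norm_pow_le_trace {ι : Type*} [Fintype ι] [DecidableEq ι] {X : Matrix ι ι ℝ}
    (hX : X.IsSymm) (k : ℕ) : ‖X‖ ^ 2 ^ (k + 1) ≤ (X ^ 2 ^ (k + 1)).trace := by
  have hsa : IsSelfAdjoint X := by
    rw [isSelfAdjoint_iff, Matrix.star_eq_conjTranspose,
      Matrix.conjTranspose_eq_transpose_of_trivial]
    exact hX
  have h1 : ‖X ^ 2 ^ k‖ = ‖X‖ ^ 2 ^ k := by
    simpa using congrArg NNReal.toReal (hsa.nnnorm_pow_two_pow k)
  have h2 : (X ^ 2 ^ k).transpose = X ^ 2 ^ k := by rw [Matrix.transpose_pow, hX.eq]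
  have h3 := norm_sq_le_trace (X ^ 2 ^ k)
  rwa [h2, h1, ← pow_mul, ← pow_succ, ← pow_two, ← pow_mul, ← pow_succ] at h3

end Norm

section EdgePaths

variable {Ω : Type} [MeasurableSpace Ω] {μ : Measure Ω} {n T : ℕ}
  {P : Matrix (Fin n) (Fin n) ℝ} {α : ℝ} {A : ℕ → Ω → Fin n → Fin n → Bool}

/-- Unordered pairs of vertices, loops included, represented by ordered pairs. -/
abbrev Edge (n : ℕ) : Type := {ij : Fin n × Fin n // ij.1 ≤ ij.2}

/-- The edge joining two vertices. -/
def edge {n : ℕ} (i j : Fin n) : Edge n := ⟨(min i j, max i j), min_le_max⟩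

lemma edge_comm {n : ℕ} (i j : Fin n) : edge i j = edge j i := by
  simp only [edge, min_comm i j, max_comm i j]

lemma edge_injective {n : ℕ} (i : Fin n) : Function.Injective (edge i) := by
  intro j k h
  simp only [edge, Subtype.mk.injEq, Prod.mk.injEq] at h
  grind

lemma edge_coe {n : ℕ} (e : Edge n) : edge e.1.1 e.1.2 = e := by
  ext <;> simp [edge, e.2]

lemma apply_edge {n : ℕ} {β : Type*} {f : Fin n → Fin n → β} (hf : ∀ i j, f i j = f j i)
    (i j : Fin n) : f (edge i j).1.1 (edge i j).1.2 = f i j := by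
  rcases le_total i j with h | h
  · simp [edge, h]
  · simp [edge, h, hf j i]

/-- The trajectory of every edge over the times `1, …, T + 1`. -/
def edgePath (T : ℕ) (A : ℕ → Ω → Fin n → Fin n → Bool) (ω : Ω) : Edge n → Fin (T + 1) → Bool :=
  fun e k => A (k + 1) ω e.1.1 e.1.2

lemma lazyTrajProb_eq_prod_chainWeight (T : ℕ) (P : Matrix (Fin n) (Fin n) ℝ) (α : ℝ)
    (m : ℕ → Fin n → Fin n → Bool) : lazyTrajProb n (T + 1) P α m =
      ∏ e : Edge n, chainWeight (P e.1.1 e.1.2) α fun k : Fin (T + 1) => m (k + 1) e.1.1 e.1.2 := by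
  unfold lazyTrajProb
  rw [← Finset.prod_subtype_eq_prod_filter]
  refine Finset.prod_congr (by ext; simp) fun e _ => ?_
  unfold chainWeight
  congr 1
  rw [← Finset.Ico_add_one_right_eq_Icc, Finset.prod_Ico_eq_prod_range,
    ← Fin.prod_univ_eq_prod_range
    (fun t => lazyStep (P e.1.1 e.1.2) α (m (2 + t - 1) e.1.1 e.1.2) (m (2 + t) e.1.1 e.1.2))]
  refine Finset.prod_congr rfl fun k _ => ?_
  rw [show 2 + (k : ℕ) - 1 = k + 1 by omega, add_comm 2]
  rfl

lemma IsLazyIER.measurable_edgePath (h : IsLazyIER μ n (T + 1) P α A) :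
    Measurable (edgePath T A) := by
  refine measurable_pi_lambda _ fun e => measurable_pi_lambda _ fun k => ?_
  exact (measurable_pi_apply e.1.2).comp ((measurable_pi_apply e.1.1).comp (h.meas (k + 1)))

lemma IsLazyIER.measureReal_edgePath_eq (h : IsLazyIER μ n (T + 1) P α A)
    (τ : Edge n → Fin (T + 1) → Bool) :
    μ.real (edgePath T A ⁻¹' {τ}) = ∏ e : Edge n, chainWeight (P e.1.1 e.1.2) α (τ e) := by
  set m : ℕ → Fin n → Fin n → Bool := fun t i j => τ (edge i j) (Fin.ofNat (T + 1) (t - 1)) with hm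
  have hlaw := h.law m fun t i j => by simp only [hm, edge_comm]
  have hmk (k : Fin (T + 1)) (i j : Fin n) : m (k + 1) i j = τ (edge i j) k := by
    simp [hm]
  rw [lazyTrajProb_eq_prod_chainWeight] at hlaw
  simp only [hmk, edge_coe] at hlaw
  rw [← hlaw, Measure.real]
  congr 2
  ext ω
  simp only [Set.mem_preimage, Set.mem_singleton_iff, Set.mem_ofPred_eq, Finset.mem_Icc]
  constructor
  · rintro rfl t ⟨ht1, ht2⟩
    obtain ⟨k, rfl⟩ : ∃ k : Fin (T + 1), (k : ℕ) + 1 = t := ⟨⟨t - 1, by omega⟩, by simp; omega⟩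
    funext i j
    rw [hmk]
    exact (apply_edge (h.A_symm _ ω) i j).symm
  · intro hω
    funext e k
    rw [edgePath, hω (k + 1) (by omega), hmk, edge_coe]

lemma IsLazyIER.integral_edgePath (h : IsLazyIER μ n (T + 1) P α A)
    (F : (Edge n → Fin (T + 1) → Bool) → ℝ) :
    ∫ ω, F (edgePath T A ω) ∂μ = prodExp (fun e => chainWeight (P e.1.1 e.1.2) α) F := by
  have := h.prob
  have hmeas := h.measurable_edgePath
  have : IsProbabilityMeasure (μ.map (edgePath T A)) :=
    Measure.isProbabilityMeasure_map hmeas.aemeasurable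
  rw [← integral_map hmeas.aemeasurable (measurable_of_finite F).aestronglyMeasurable,
    integral_fintype Integrable.of_finite]
  refine Finset.sum_congr rfl fun τ _ => ?_
  rw [map_measureReal_apply hmeas (measurableSet_singleton τ), h.measureReal_edgePath_eq,
    smul_eq_mul]

lemma IsLazyIER.aggE_eq_pathSum (h : IsLazyIER μ n (T + 1) P α A) (ω : Ω) (i j : Fin n) :
    aggE n (T + 1) A ω i j = pathSum (edgePath T A ω (edge i j)) := by
  unfold aggE pathSum edgePath
  simp only [apply_edge (h.A_symm _ ω)]
  rw [← Finset.Ico_add_one_right_eq_Icc, Finset.sum_Ico_eq_sum_range, ← Fin.sum_univ_eq_sum_range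
    (fun t => if A (1 + t) ω i j then (1 : ℝ) else 0)]
  simp [add_comm]

lemma IsLazyIER.aggMean_apply (h : IsLazyIER μ n (T + 1) P α A) (i j : Fin n) :
    aggMean μ n (T + 1) A i j = (T + 1) * P i j := by
  simp only [aggMean, Matrix.of_apply, h.aggE_eq_pathSum]
  rw [h.integral_edgePath fun τ => pathSum (τ (edge i j))]
  have hprod := prodExp_prod (fun e : Edge n => chainWeight (T := T) (P e.1.1 e.1.2) α)
    fun e b => if e = edge i j then pathSum b else 1
  simp only [Finset.prod_ite_eq', Finset.mem_univ, if_true] at hprod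
  rw [hprod, Finset.prod_eq_single (edge i j)]
  · simp only [if_true, sum_chainWeight_pathSum, apply_edge h.P_symm]
  · intro e _ he
    simp [he, sum_chainWeight]
  · simp

lemma IsLazyIER.aggMatrix_sub_aggMean (h : IsLazyIER μ n (T + 1) P α A) (ω : Ω) :
    aggMatrix n (T + 1) A ω - aggMean μ n (T + 1) A = Matrix.of fun i j =>
      pathSum (edgePath T A ω (edge i j)) - (T + 1) * P (edge i j).1.1 (edge i j).1.2 := by
  ext i j
  rw [Matrix.sub_apply, h.aggMean_apply, Matrix.of_apply, apply_edge h.P_symm, aggMatrix,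
    Matrix.of_apply, h.aggE_eq_pathSum]

lemma IsLazyIER.isSymm (h : IsLazyIER μ n (T + 1) P α A) (ω : Ω) :
    (aggMatrix n (T + 1) A ω - aggMean μ n (T + 1) A).IsSymm := by
  rw [h.aggMatrix_sub_aggMean]
  ext i j
  simp only [Matrix.transpose_apply, Matrix.of_apply, edge_comm]

lemma sum_le_dMax (P : Matrix (Fin n) (Fin n) ℝ) (i : Fin n) : ∑ j, P i j ≤ dMax P :=
  le_ciSup (f := fun i => ∑ j, P i j) (Set.finite_range _).bddAbove i

lemma IsLazyIER.integrable_trace_pow (h : IsLazyIER μ n (T + 1) P α A) (N : ℕ) :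
    Integrable (fun ω => ((aggMatrix n (T + 1) A ω - aggMean μ n (T + 1) A) ^ N).trace) μ := by
  have := h.prob
  have : IsProbabilityMeasure (μ.map (edgePath T A)) :=
    Measure.isProbabilityMeasure_map h.measurable_edgePath.aemeasurable
  simp only [h.aggMatrix_sub_aggMean]
  exact (Integrable.of_finite (μ := μ.map (edgePath T A))
    (f := fun τ : Edge n → Fin (T + 1) → Bool => ((Matrix.of fun i j =>
      pathSum (τ (edge i j)) - (T + 1) * P (edge i j).1.1 (edge i j).1.2 :
        Matrix (Fin n) (Fin n) ℝ) ^ N).trace)).comp_measurable h.measurable_edgePath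

/-- Expected traces of powers of the centred aggregated adjacency matrix. -/
lemma exists_integral_trace_pow_le {α : ℝ} (hα : α ∈ Set.Ioo (0 : ℝ) 1) :
    ∃ K : ℝ, 0 < K ∧ ∀ (n T : ℕ) (P : Matrix (Fin n) (Fin n) ℝ) (Ω : Type) (_ : MeasurableSpace Ω)
      (μ : Measure Ω) (A : ℕ → Ω → Fin n → Fin n → Bool), IsLazyIER μ n (T + 1) P α A →
      ∀ N : ℕ, 0 < N → (N : ℝ) ≤ (T + 1) * dMax P →
        ∫ ω, ((aggMatrix n (T + 1) A ω - aggMean μ n (T + 1) A) ^ N).trace ∂μ ≤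
          n * (K * (5 * √(N * ((T + 1) * dMax P)))) ^ N := by
  obtain ⟨K, hK, hmom⟩ := exists_moment_bound hα
  refine ⟨K, hK, fun n T P Ω _ μ A h N hN hNσ => ?_⟩
  simp only [h.aggMatrix_sub_aggMean]
  rw [h.integral_edgePath fun τ => ((Matrix.of fun i j =>
      pathSum (τ (edge i j)) - (T + 1) * P (edge i j).1.1 (edge i j).1.2 :
        Matrix (Fin n) (Fin n) ℝ) ^ N).trace]
  have hrow (i : Fin n) : ∑ k, ((T : ℝ) + 1) * P (edge i k).1.1 (edge i k).1.2 ≤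
      (T + 1) * dMax P := by
    simp only [apply_edge h.P_symm, ← Finset.mul_sum]
    exact mul_le_mul_of_nonneg_left (sum_le_dMax P i) (by positivity)
  simpa using prodExp_trace_pow_le (fun e : Edge n => chainWeight (P e.1.1 e.1.2) α)
    (fun e b => pathSum b - (T + 1) * P e.1.1 e.1.2) edge edge_injective
    (fun e => (T + 1) * P e.1.1 e.1.2) (fun e => mul_nonneg (by positivity) (h.P_mem _ _).1)
    hK.le hrow (fun a ha e m => hmom _ (h.P_mem _ _) T a ha m) hN hNσ

end EdgePaths

lemma exists_dyadic_exponent {c δ : ℝ} (hc : 0 < c) {n : ℕ} (hn : 2 ≤ n)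
    (hδ : (n : ℝ) ^ (-c) < δ) (hδ2 : δ < 1 / 2) :
    ∃ k : ℕ, Real.log (n / δ) ≤ (2 ^ (k + 1) : ℕ) ∧
      ((2 ^ (k + 1) : ℕ) : ℝ) ≤ 2 * Real.log (n / δ) ∧
      ((2 ^ (k + 1) : ℕ) : ℝ) ≤ 5 * (1 + c) * Real.log n ^ 3 := by
  have hn' : (2 : ℝ) ≤ n := by exact_mod_cast hn
  have hn0 : (0 : ℝ) < n := by linarith
  have hδ0 : 0 < δ := (Real.rpow_pos_of_pos hn0 _).trans hδ
  have hlog2 := Real.log_two_gt_d9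
  have hlogn : Real.log 2 ≤ Real.log n := Real.log_le_log two_pos hn'
  have hlogδ : -c * Real.log n ≤ Real.log δ := by
    rw [← Real.log_rpow hn0]
    exact Real.log_le_log (Real.rpow_pos_of_pos hn0 _) hδ.le
  have hlogδ2 : Real.log δ ≤ -Real.log 2 := by
    rw [← Real.log_inv]
    exact Real.log_le_log hδ0 (by linarith)
  rw [Real.log_div hn0.ne' hδ0.ne']
  obtain ⟨k, hk1, hk2⟩ := exists_nat_pow_near
    (show 1 ≤ Real.log n - Real.log δ by linarith) (one_lt_two : (1 : ℝ) < 2)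
  refine ⟨k, by push_cast; exact hk2.le, ?_, ?_⟩ <;> push_cast <;> rw [pow_succ]
  · linarith
  · have h1 : 2 ^ k * 2 ≤ 2 * (1 + c) * Real.log n := by linarith
    have h2 : (0.4 : ℝ) ≤ Real.log n ^ 2 := by nlinarith
    have h3 : 0 ≤ (1 + c) * Real.log n := by
      have : 0 ≤ Real.log n := by linarith
      positivity
    nlinarith [mul_le_mul_of_nonneg_left h2 h3]

/-- **Theorem (concentration of the aggregated adjacency matrix).**
For any constant `c > 0` there exists a constant `C = C(c) > 0` (independent of
`n, T, P, α`) such that: if `T·d_max > C (log n)^3`, then there is a constant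
`C₁ = C₁(α, c)` such that for every `δ ∈ (n^{-c}, 1/2)`, with probability at
least `1 - δ`, `‖A - Ā‖ ≤ C₁ √(T · d_max · log(n/δ))`. -/
theorem lazyIER_aggAdj_concentration :
    ∀ c : ℝ, 0 < c → ∃ C : ℝ, 0 < C ∧
      ∀ α : ℝ, α ∈ Set.Ioo (0 : ℝ) 1 →
        ∃ C₁ : ℝ,
          ∀ (n T : ℕ) (P : Matrix (Fin n) (Fin n) ℝ)
            (Ω : Type) (_ : MeasurableSpace Ω) (μ : Measure Ω)
            (A : ℕ → Ω → Fin n → Fin n → Bool),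
            IsLazyIER μ n T P α A →
            (T : ℝ) * dMax P > C * (Real.log n) ^ 3 →
            ∀ δ : ℝ, (n : ℝ) ^ (-c) < δ → δ < 1 / 2 →
              (μ {ω | opNorm (aggMatrix n T A ω - aggMean μ n T A) ≤
                  C₁ * Real.sqrt ((T : ℝ) * dMax P * Real.log ((n : ℝ) / δ))}).toReal
                ≥ 1 - δ := by
  intro c hc
  refine ⟨5 * (1 + c), by positivity, fun α hα => ?_⟩
  obtain ⟨K, hK, htrace⟩ := exists_integral_trace_pow_le hα
  refine ⟨10 * rexp 1 * K, fun n T P Ω _ μ A h hC δ hδ hδ2 => ?_⟩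
  have := h.prob
  obtain ⟨T, rfl⟩ : ∃ T', T = T' + 1 := ⟨T - 1, by have := h.two_le_T; omega⟩
  have hn : 2 ≤ n := by
    match n with
    | 0 => simp [dMax] at hC
    | 1 =>
      rw [Nat.cast_one, Real.one_rpow] at hδ
      linarith
    | n + 2 => omega
  obtain ⟨k, hk1, hk2, hk3⟩ := exists_dyadic_exponent hc hn hδ hδ2
  set ℓ := Real.log (n / δ) with hℓ
  set N := 2 ^ (k + 1) with hN
  push_cast at hC ⊢
  set σ := ((T : ℝ) + 1) * dMax P with hσ
  have hNσ : (N : ℝ) ≤ σ := hk3.trans hC.le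
  have hN0 : (0 : ℝ) < N := by positivity
  have hσ0 : 0 < σ := hN0.trans_le hNσ
  have hn0 : (0 : ℝ) < n := by positivity
  have hδ0 : 0 < δ := (by positivity : 0 ≤ (n : ℝ) ^ (-c)).trans_lt hδ
  set R := √(N * σ) with hR
  have hR0 : 0 < R := Real.sqrt_pos.2 (by positivity)
  set t := rexp 1 * (K * (5 * R)) with ht
  have hRle : R ≤ 2 * √(σ * ℓ) := by
    rw [hR, Real.sqrt_le_left (by positivity), mul_pow, Real.sq_sqrt (by nlinarith)]
    nlinarith
  have htle : t ≤ 10 * rexp 1 * K * √(σ * ℓ) := by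
    calc t = 5 * rexp 1 * K * R := by rw [ht]; ring
      _ ≤ 5 * rexp 1 * K * (2 * √(σ * ℓ)) := by gcongr
      _ = _ := by ring
  set X := fun ω => aggMatrix n (T + 1) A ω - aggMean μ n (T + 1) A with hX
  have hnorm (ω : Ω) : opNorm (X ω) ^ N ≤ (X ω ^ N).trace := by
    rw [opNorm_eq_norm]
    exact norm_pow_le_trace (h.isSymm ω) k
  have hnn (ω : Ω) : 0 ≤ opNorm (X ω) := norm_nonneg _
  have hmarkov := mul_meas_ge_le_integral_of_nonneg
    (Filter.Eventually.of_forall fun ω => (pow_nonneg (hnn ω) N).trans (hnorm ω))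
    (h.integrable_trace_pow N) (t ^ N)
  have htail : μ.real {ω | t ^ N ≤ (X ω ^ N).trace} ≤ δ := by
    have h1 := hmarkov.trans (htrace n T P Ω _ μ A h N (by positivity) hNσ)
    have h2 : (n : ℝ) ≤ δ * rexp 1 ^ N := by
      rw [← Real.exp_nat_mul, mul_one, ← div_le_iff₀' hδ0]
      exact (Real.log_le_iff_le_exp (by positivity)).1 hk1
    have h3 : 0 < (K * (5 * R)) ^ N := by positivity
    refine le_of_mul_le_mul_left ?_ (by positivity : 0 < t ^ N)
    calc _ ≤ _ := h1
      _ ≤ δ * rexp 1 ^ N * (K * (5 * R)) ^ N := by gcongr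
      _ = t ^ N * δ := by rw [ht, mul_pow]; ring
  have hcompl : {ω | t ^ N ≤ (X ω ^ N).trace}ᶜ ⊆
      {ω | opNorm (X ω) ≤ 10 * rexp 1 * K * √(σ * ℓ)} := by
    intro ω hω
    have h1 : (X ω ^ N).trace < t ^ N := not_le.1 hω
    exact (lt_of_pow_lt_pow_left₀ N (by positivity) ((hnorm ω).trans_lt h1)).le.trans htle
  have hunion : 1 ≤ μ.real {ω | t ^ N ≤ (X ω ^ N).trace} +
      μ.real {ω | t ^ N ≤ (X ω ^ N).trace}ᶜ := by
    rw [← probReal_univ (μ := μ), ← Set.union_compl_self {ω | t ^ N ≤ (X ω ^ N).trace}]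
    exact measureReal_union_le _ _
  have hmono := measureReal_mono (μ := μ) hcompl
  change μ.real {ω | opNorm (X ω) ≤ 10 * rexp 1 * K * √(σ * ℓ)} ≥ 1 - δ
  linarith
end
end

section
/- Let (A^{(t)}, t ∈ [T]) follow the lazy IER process on [n] with mean matrix P = ((p_ij)) and laziness parameter α ∈ (0,1), and let a_ij = Σ_{t=1}^T A^{(t)}_ij. If √T > log_{1/α}(T) (and T is sufficiently large depending on α), then Var(a_ij) ≤ T p_ij (3 − α)/(1 − α) for all i, j ∈ [n]. -/
open MeasureTheory ProbabilityTheory Finset Real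

noncomputable section

/-- Probability of the trajectory `y` under a single stationary lazy Bernoulli chain. -/
def lazyChainProb (p α : ℝ) (k : ℕ) (y : Fin (k + 1) → Bool) : ℝ :=
  bernProb p (y 0) * ∏ t : Fin k, lazyStep p α (y t.castSucc) (y t.succ)

/-- The state of a Bernoulli variable, centred at its mean `p`. -/
def centredState (p : ℝ) (b : Bool) : ℝ := (if b then 1 else 0) - p

lemma lazyChainProb_snoc (p α : ℝ) (k : ℕ) (y : Fin (k + 1) → Bool) (b : Bool) :
    lazyChainProb p α (k + 1) (Fin.snoc (α := fun _ => Bool) y b) =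
      lazyChainProb p α k y * lazyStep p α (y (Fin.last k)) b := by
  unfold lazyChainProb
  rw [Fin.prod_univ_castSucc, ← mul_assoc]
  congr 1
  · congr 1
    refine Finset.prod_congr rfl fun t _ => ?_
    rw [Fin.snoc_castSucc, Fin.succ_castSucc, Fin.snoc_castSucc]
  · rw [Fin.snoc_castSucc, Fin.succ_last, Fin.snoc_last]

lemma sum_fin_succ_arrow_eq_sum_snoc (k : ℕ) (F : (Fin (k + 1) → Bool) → ℝ) :
    ∑ y, F y = ∑ y : Fin k → Bool, ∑ b, F (Fin.snoc (α := fun _ => Bool) y b) := by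
  rw [← (Fin.snocEquiv fun _ : Fin (k + 1) => Bool).sum_comp, Fintype.sum_prod_type_right]
  rfl

lemma sum_lazyStep (p α : ℝ) (a : Bool) : ∑ b, lazyStep p α a b = 1 := by
  cases a <;> simp [lazyStep, bernProb] <;> ring

lemma sum_lazyStep_mul_centredState (p α : ℝ) (a : Bool) :
    ∑ b, lazyStep p α a b * centredState p b = α * centredState p a := by
  cases a <;> simp [lazyStep, bernProb, centredState] <;> ring

lemma sum_lazyStep_mul_centredState_sq (p α : ℝ) (a : Bool) :
    ∑ b, lazyStep p α a b * centredState p b ^ 2 =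
      α * centredState p a ^ 2 + (1 - α) * (p * (1 - p)) := by
  cases a <;> simp [lazyStep, bernProb, centredState] <;> ring

lemma sum_lazyChainProb (p α : ℝ) (k : ℕ) : ∑ y, lazyChainProb p α k y = 1 := by
  induction k with
  | zero =>
    rw [sum_fin_succ_arrow_eq_sum_snoc]
    simp [lazyChainProb, bernProb, Fin.snoc]
  | succ k ih =>
    rw [sum_fin_succ_arrow_eq_sum_snoc]
    simp_rw [lazyChainProb_snoc, ← Finset.mul_sum, sum_lazyStep, mul_one, ih]

lemma sum_lazyChainProb_mul_last_sq (p α : ℝ) (k : ℕ) :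
    ∑ y, lazyChainProb p α k y * centredState p (y (Fin.last k)) ^ 2 = p * (1 - p) := by
  induction k with
  | zero =>
    rw [sum_fin_succ_arrow_eq_sum_snoc]
    simp [lazyChainProb, bernProb, centredState, Fin.snoc]
    ring
  | succ k ih =>
    rw [sum_fin_succ_arrow_eq_sum_snoc]
    simp_rw [lazyChainProb_snoc, Fin.snoc_last, mul_assoc, ← Finset.mul_sum,
      sum_lazyStep_mul_centredState_sq, mul_add, Finset.sum_add_distrib, ← Finset.sum_mul,
      sum_lazyChainProb, mul_left_comm _ α, ← Finset.mul_sum, ih]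
    ring

/-- Covariance of the last state of the chain with the sum of all its states. -/
def lazyChainCov (p α : ℝ) (k : ℕ) : ℝ :=
  ∑ y, lazyChainProb p α k y * (centredState p (y (Fin.last k)) * ∑ t, centredState p (y t))

/-- Variance of the sum of all states of the chain. -/
def lazyChainVar (p α : ℝ) (k : ℕ) : ℝ :=
  ∑ y, lazyChainProb p α k y * (∑ t, centredState p (y t)) ^ 2

lemma lazyChainCov_zero (p α : ℝ) : lazyChainCov p α 0 = p * (1 - p) := by
  rw [← sum_lazyChainProb_mul_last_sq p α 0]
  simp [lazyChainCov, sq]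

lemma lazyChainVar_zero (p α : ℝ) : lazyChainVar p α 0 = p * (1 - p) := by
  rw [← sum_lazyChainProb_mul_last_sq p α 0]
  simp [lazyChainVar]

lemma lazyChainCov_succ (p α : ℝ) (k : ℕ) :
    lazyChainCov p α (k + 1) = α * lazyChainCov p α k + p * (1 - p) := by
  rw [← sum_lazyChainProb_mul_last_sq p α (k + 1), lazyChainCov, lazyChainCov,
    sum_fin_succ_arrow_eq_sum_snoc, sum_fin_succ_arrow_eq_sum_snoc (k + 1) fun y => _ * _ ^ 2,
    Finset.mul_sum, ← Finset.sum_add_distrib]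
  refine Finset.sum_congr rfl fun y _ => ?_
  have h := sum_lazyStep_mul_centredState p α (y (Fin.last k))
  simp only [lazyChainProb_snoc, Fin.snoc_last, Fin.sum_univ_castSucc (n := k + 1),
    Fin.snoc_castSucc, Fintype.sum_bool] at h ⊢
  linear_combination (lazyChainProb p α k y * ∑ t, centredState p (y t)) * h

lemma lazyChainVar_succ (p α : ℝ) (k : ℕ) :
    lazyChainVar p α (k + 1) =
      lazyChainVar p α k + 2 * α * lazyChainCov p α k + p * (1 - p) := by
  rw [← sum_lazyChainProb_mul_last_sq p α (k + 1), lazyChainVar, lazyChainVar, lazyChainCov,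
    sum_fin_succ_arrow_eq_sum_snoc, sum_fin_succ_arrow_eq_sum_snoc (k + 1) fun y => _ * _ ^ 2,
    Finset.mul_sum, ← Finset.sum_add_distrib, ← Finset.sum_add_distrib]
  refine Finset.sum_congr rfl fun y _ => ?_
  have h := sum_lazyStep_mul_centredState p α (y (Fin.last k))
  have h1 := sum_lazyStep p α (y (Fin.last k))
  simp only [lazyChainProb_snoc, Fin.snoc_last, Fin.sum_univ_castSucc (n := k + 1),
    Fin.snoc_castSucc, Fintype.sum_bool] at h h1 ⊢
  linear_combination (2 * lazyChainProb p α k y * ∑ t, centredState p (y t)) * h +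
    (lazyChainProb p α k y * (∑ t, centredState p (y t)) ^ 2) * h1

lemma lazyChainCov_le {p α : ℝ} (hp : p ∈ Set.Icc (0 : ℝ) 1) (hα : α ∈ Set.Ioo (0 : ℝ) 1)
    (k : ℕ) : lazyChainCov p α k ≤ p * (1 - p) / (1 - α) := by
  have h1 : 0 < 1 - α := sub_pos.2 hα.2
  have hv : 0 ≤ p * (1 - p) := mul_nonneg hp.1 (sub_nonneg.2 hp.2)
  induction k with
  | zero =>
    rw [lazyChainCov_zero, le_div_iff₀ h1]
    nlinarith [mul_nonneg hv hα.1.le]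
  | succ k ih =>
    rw [lazyChainCov_succ]
    calc α * lazyChainCov p α k + p * (1 - p)
        ≤ α * (p * (1 - p) / (1 - α)) + p * (1 - p) := by gcongr; exact hα.1.le
      _ = p * (1 - p) / (1 - α) := by field_simp; ring

lemma lazyChainVar_le {p α : ℝ} (hp : p ∈ Set.Icc (0 : ℝ) 1) (hα : α ∈ Set.Ioo (0 : ℝ) 1)
    (k : ℕ) : lazyChainVar p α k ≤ (k + 1) * (p * (1 - p) * ((1 + α) / (1 - α))) := by
  have h1 : 0 < 1 - α := sub_pos.2 hα.2
  have hv : 0 ≤ p * (1 - p) := mul_nonneg hp.1 (sub_nonneg.2 hp.2)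
  induction k with
  | zero =>
    rw [lazyChainVar_zero, Nat.cast_zero, zero_add, one_mul]
    refine le_mul_of_one_le_right hv ((one_le_div h1).2 ?_)
    linarith [hα.1]
  | succ k ih =>
    have h2 : 2 * α * lazyChainCov p α k ≤ 2 * α * (p * (1 - p) / (1 - α)) :=
      mul_le_mul_of_nonneg_left (lazyChainCov_le hp hα k) (by linarith [hα.1])
    have h3 : p * (1 - p) * ((1 + α) / (1 - α)) =
        2 * α * (p * (1 - p) / (1 - α)) + p * (1 - p) := by field_simp; ring
    rw [lazyChainVar_succ]
    push_cast
    linarith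

/-- The marginal of a product weight at the coordinate `e`. -/
lemma sum_prod_mul_apply {ι κ : Type*} [Fintype ι] [DecidableEq ι] [Fintype κ]
    (w : ι → κ → ℝ) (hw : ∀ i, ∑ y, w i y = 1) (e : ι) (G : κ → ℝ) :
    ∑ x : ι → κ, (∏ i, w i (x i)) * G (x e) = ∑ y, w e y * G y := by
  have h := Finset.prod_univ_sum (fun _ : ι => (Finset.univ : Finset κ))
    (fun i y => w i y * if i = e then G y else 1)
  rw [Fintype.piFinset_univ] at h
  simp_rw [Finset.prod_mul_distrib, Finset.prod_ite_eq' Finset.univ e,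
    Finset.mem_univ, if_true] at h
  rw [← h, Finset.prod_eq_single e]
  · simp
  · intro i _ hi
    simp [hi, hw]
  · simp

/-- The unordered pairs `i ≤ j` indexing the independent edges. -/
abbrev OrderedPair (n : ℕ) : Type := {ij : Fin n × Fin n // ij.1 ≤ ij.2}

/-- The symmetric trajectory with prescribed edge trajectories. -/
def symmTraj {n k : ℕ} (x : OrderedPair n → Fin (k + 1) → Bool) (t : ℕ) (i j : Fin n) : Bool :=
  x ⟨(min i j, max i j), min_le_max⟩ (Fin.ofNat (k + 1) (t - 1))

lemma symmTraj_comm {n k : ℕ} (x : OrderedPair n → Fin (k + 1) → Bool) (t : ℕ) (i j : Fin n) :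
    symmTraj x t i j = symmTraj x t j i := by
  simp only [symmTraj, min_comm i j, max_comm i j]

lemma symmTraj_apply {n k : ℕ} (x : OrderedPair n → Fin (k + 1) → Bool) (t : ℕ)
    (e : OrderedPair n) :
    symmTraj x t e.1.1 e.1.2 = x e (Fin.ofNat (k + 1) (t - 1)) := by
  simp only [symmTraj, min_eq_left e.2, max_eq_right e.2]

lemma lazyTrajProb_symmTraj {n k : ℕ} (P : Matrix (Fin n) (Fin n) ℝ) (α : ℝ)
    (x : OrderedPair n → Fin (k + 1) → Bool) :
    lazyTrajProb n (k + 1) P α (symmTraj x) =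
      ∏ e : OrderedPair n, lazyChainProb (P e.1.1 e.1.2) α k (x e) := by
  rw [lazyTrajProb, Finset.prod_subtype (p := fun ij : Fin n × Fin n => ij.1 ≤ ij.2) _ (by simp)]
  refine Finset.prod_congr rfl fun e _ => ?_
  simp only [symmTraj_apply, lazyChainProb]
  congr 1
  rw [← Finset.Ico_add_one_right_eq_Icc, Finset.prod_Ico_eq_prod_range,
    show k + 1 + 1 - 2 = k by omega, Finset.prod_range]
  refine Finset.prod_congr rfl fun t _ => ?_
  congr 2
  · ext
    have : 2 + (t : ℕ) - 1 - 1 = t := by omega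
    simp only [Fin.val_ofNat, this, Fin.val_castSucc]
    exact Nat.mod_eq_of_lt (by omega)
  · ext
    have : 2 + (t : ℕ) - 1 = t + 1 := by omega
    simp only [Fin.val_ofNat, this, Fin.val_succ]
    exact Nat.mod_eq_of_lt (by omega)

/-- The family of edge trajectories of a process of adjacency matrices. -/
def edgeTraj {Ω : Type} {n : ℕ} (k : ℕ) (A : ℕ → Ω → Fin n → Fin n → Bool) (ω : Ω)
    (e : OrderedPair n) (t : Fin (k + 1)) : Bool :=
  A (t + 1) ω e.1.1 e.1.2

lemma edgeTraj_eq_iff {Ω : Type} {n k : ℕ} {A : ℕ → Ω → Fin n → Fin n → Bool}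
    (hA : ∀ t ω i j, A t ω i j = A t ω j i) (ω : Ω) (x : OrderedPair n → Fin (k + 1) → Bool) :
    edgeTraj k A ω = x ↔ ∀ t ∈ Finset.Icc 1 (k + 1), A t ω = symmTraj x t := by
  constructor
  · rintro rfl t ht
    obtain ⟨h1, h2⟩ := Finset.mem_Icc.1 ht
    have h3 : (t - 1) % (k + 1) + 1 = t := by rw [Nat.mod_eq_of_lt (by omega)]; omega
    ext i j
    simp only [symmTraj, edgeTraj, Fin.val_ofNat, h3]
    rcases le_total i j with h | h
    · rw [min_eq_left h, max_eq_right h]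
    · rw [min_eq_right h, max_eq_left h, hA]
  · intro h
    ext e t
    rw [edgeTraj, h _ (Finset.mem_Icc.2 ⟨by omega, by omega⟩), symmTraj_apply]
    simp

lemma IsLazyIER.integral_edgeTraj {Ω : Type} [MeasurableSpace Ω] {μ : Measure Ω} {n k : ℕ}
    {P : Matrix (Fin n) (Fin n) ℝ} {α : ℝ} {A : ℕ → Ω → Fin n → Fin n → Bool}
    (h : IsLazyIER μ n (k + 1) P α A) (e : OrderedPair n) (G : (Fin (k + 1) → Bool) → ℝ) :
    ∫ ω, G (edgeTraj k A ω e) ∂μ = ∑ y, lazyChainProb (P e.1.1 e.1.2) α k y * G y := by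
  have := h.prob
  have hX : Measurable (edgeTraj k A) := by
    refine measurable_pi_iff.2 fun e => measurable_pi_iff.2 fun t => ?_
    exact (measurable_pi_apply e.1.2).comp ((measurable_pi_apply e.1.1).comp (h.meas (t + 1)))
  have := Measure.isProbabilityMeasure_map (μ := μ) hX.aemeasurable
  rw [← sum_prod_mul_apply (fun e : OrderedPair n => lazyChainProb (P e.1.1 e.1.2) α k)
      (fun e => sum_lazyChainProb _ _ _) e G,
    ← integral_map (μ := μ) (φ := edgeTraj k A) (f := fun x => G (x e)) hX.aemeasurable
      (Measurable.of_discrete.aestronglyMeasurable),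
    integral_fintype .of_finite]
  refine Finset.sum_congr rfl fun x _ => ?_
  rw [← lazyTrajProb_symmTraj, ← h.law _ (symmTraj_comm x), smul_eq_mul,
    map_measureReal_apply hX (measurableSet_singleton x), measureReal_def]
  congr 3
  ext ω
  exact edgeTraj_eq_iff h.A_symm ω x

lemma aggE_sub_eq_sum_centredState {Ω : Type} {n k : ℕ} (A : ℕ → Ω → Fin n → Fin n → Bool)
    (p : ℝ) (ω : Ω) (e : OrderedPair n) :
    aggE n (k + 1) A ω e.1.1 e.1.2 - (k + 1) * p =
      ∑ t, centredState p (edgeTraj k A ω e t) := by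
  rw [aggE, ← Finset.Ico_add_one_right_eq_Icc, Finset.sum_Ico_eq_sum_range, Nat.add_sub_cancel,
    Finset.sum_range]
  simp only [centredState, edgeTraj, add_comm 1, Finset.sum_sub_distrib, Finset.sum_const,
    Finset.card_univ, Fintype.card_fin, nsmul_eq_mul, Nat.cast_add, Nat.cast_one]
  rfl

lemma IsLazyIER.variance_aggE_le {Ω : Type} [MeasurableSpace Ω] {μ : Measure Ω} {n T : ℕ}
    {P : Matrix (Fin n) (Fin n) ℝ} {α : ℝ} {A : ℕ → Ω → Fin n → Fin n → Bool}
    (h : IsLazyIER μ n T P α A) (i j : Fin n) :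
    variance (fun ω => aggE n T A ω i j) μ ≤
      T * (P i j * (1 - P i j) * ((1 + α) / (1 - α))) := by
  wlog hij : i ≤ j generalizing i j
  · have hsymm := this j i (le_of_not_ge hij)
    simpa only [aggE, h.A_symm _ _ j i, h.P_symm j i] using hsymm
  have := h.prob
  obtain ⟨k, rfl⟩ : ∃ k, T = k + 1 := ⟨T - 1, by have := h.two_le_T; omega⟩
  have hmeas : Measurable fun ω => aggE n (k + 1) A ω i j := by
    refine Finset.measurable_fun_sum _ fun t _ => ?_
    exact (Measurable.of_discrete (f := fun m : Fin n → Fin n → Bool =>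
      if m i j then (1 : ℝ) else 0)).comp (h.meas t)
  rw [← variance_sub_const hmeas.aestronglyMeasurable ((k + 1) * P i j)]
  refine (variance_le_expectation_sq (hmeas.sub_const _).aestronglyMeasurable).trans ?_
  refine Eq.trans_le ?_ ((lazyChainVar_le (h.P_mem i j) h.alpha_mem k).trans_eq (by push_cast; rfl))
  rw [lazyChainVar, ← h.integral_edgeTraj ⟨(i, j), hij⟩ fun y =>
    (∑ t, centredState (P i j) (y t)) ^ 2]
  refine integral_congr_ae (.of_forall fun ω => ?_)
  simp only [Pi.pow_apply, ← aggE_sub_eq_sum_centredState]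

/-- **Lemma (variance of the aggregated edge count).** If `√T > log_{1/α}(T)`
and `T` is sufficiently large (depending on `α`), then
`Var(a_ij) ≤ T p_ij (3-α)/(1-α)` for all `i, j`. -/
theorem lazyIER_aggE_variance :
    ∀ α : ℝ, α ∈ Set.Ioo (0 : ℝ) 1 →
      ∃ T₀ : ℕ,
        ∀ (n T : ℕ) (P : Matrix (Fin n) (Fin n) ℝ)
          (Ω : Type) (_ : MeasurableSpace Ω) (μ : Measure Ω)
          (A : ℕ → Ω → Fin n → Fin n → Bool),
          IsLazyIER μ n T P α A →
          T₀ ≤ T →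
          Real.sqrt T > Real.log T / Real.log (1 / α) →
          ∀ i j, variance (fun ω => aggE n T A ω i j) μ ≤
            (T : ℝ) * P i j * ((3 - α) / (1 - α)) := by
  intro α hα
  refine ⟨0, fun n T P Ω _ μ A h _ _ i j => (h.variance_aggE_le i j).trans ?_⟩
  have h1 : 0 < 1 - α := sub_pos.2 hα.2
  obtain ⟨hp0, hp1⟩ := h.P_mem i j
  rw [mul_assoc (T : ℝ) (P i j)]
  have hc : (1 + α) / (1 - α) ≤ (3 - α) / (1 - α) := by
    gcongr
    linarith [hα.2]
  refine mul_le_mul_of_nonneg_left (mul_le_mul ?_ hc ?_ hp0) T.cast_nonneg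
  · nlinarith
  · exact div_nonneg (by linarith [hα.1]) h1.le
end
end
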